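/- Let k ≥ 2, let F_k be the free group on k generators, and let t ∈ F_k have even word length ℓ(t) = 2m for some m ∈ ℕ. Then the sequence of real numbers |T_n(t)| / |B_n|, where T_n(t) := {h ∈ F_k : ℓ(h) ≤ n and ℓ(t·h) ≤ n} and B_n := {h ∈ F_k : ℓ(h) ≤ n}, converges to 1 / (2k−1)^m as n → ∞. -/

import Mathlib

namespace FreeGroup

section Midpoint

variable {α : Type*} [DecidableEq α]

/-- If `A ++ B` is reduced and `A`, `B` have equal length, then a reduced word can be appended
without cancellation to `A` or to the inverse of `B`. -/
theorem IsReduced.append_or_invRev_append {A B G : List (α × Bool)} (hAB : IsReduced (A ++ B))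
    (hlen : A.length = B.length) (hG : IsReduced G) :
    IsReduced (A ++ G) ∨ IsReduced (invRev B ++ G) := by
  have hA : IsReduced A := (List.isChain_append.1 hAB).1
  have hB : IsReduced (invRev B) := by
    rw [isReduced_iff_reduce_eq, reduce_invRev,
      IsReduced.reduce_eq (List.isChain_append.1 hAB).2.1]
  rcases G with _ | ⟨g, G⟩
  · left; simpa using hA
  rcases List.eq_nil_or_concat A with rfl | ⟨A, a, rfl⟩
  · left; simpa using hG
  rcases B with _ | ⟨b, B⟩
  · simp at hlen
  have hab := (List.isChain_append.1 hAB).2.2 a (by simp) b (by simp)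
  by_cases h : a.1 = g.1 → a.2 = g.2
  · left
    refine List.isChain_append.2 ⟨hA, hG, ?_⟩
    intro x hx y hy
    simp at hx hy
    subst hx hy
    exact h
  · right
    refine List.isChain_append.2 ⟨hB, hG, ?_⟩
    intro x hx y hy
    simp [invRev] at hx hy
    subst hx hy
    grind

theorem norm_mk_of_isReduced {L : List (α × Bool)} (h : IsReduced L) :
    (mk L).norm = L.length := by
  rw [norm, toWord_mk, h.reduce_eq]

/-- An element of length `2 * m` factors as `a * b` with both factors of length `m`, and the
inverse of `b` is the midpoint of `1` and the inverse of the element. -/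
theorem exists_midpoint (t : FreeGroup α) (m : ℕ) (ht : t.norm = 2 * m) :
    ∃ b : FreeGroup α, ∀ (g : FreeGroup α) (n : ℕ),
      ((b⁻¹ * g).norm ≤ n ∧ (t * (b⁻¹ * g)).norm ≤ n) ↔ m + g.norm ≤ n := by
  obtain ⟨A, B, hAB, hA, hB⟩ : ∃ A B, A ++ B = t.toWord ∧ A.length = m ∧ B.length = m := by
    refine ⟨t.toWord.take m, t.toWord.drop m, List.take_append_drop _ _, ?_, ?_⟩ <;>
    · simp only [List.length_take, List.length_drop]
      change t.toWord.length = 2 * m at ht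
      omega
  have hred : IsReduced (A ++ B) := hAB ▸ isReduced_toWord
  have htm : t = mk A * mk B := by rw [mul_mk, hAB, mk_toWord]
  refine ⟨mk B, fun g n => ?_⟩
  have h1 : t * ((mk B)⁻¹ * g) = mk A * g := by rw [htm]; group
  have hAn : (mk A).norm ≤ m := hA ▸ norm_mk_le
  have hBn : (mk B)⁻¹.norm ≤ m := by rw [norm_inv_eq]; exact hB ▸ norm_mk_le
  rw [h1]
  constructor
  · rintro ⟨h2, h3⟩
    rcases hred.append_or_invRev_append (hA.trans hB.symm) (isReduced_toWord (x := g))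
      with h | h
    · have := norm_mk_of_isReduced h
      rw [← mul_mk, mk_toWord, List.length_append, hA] at this
      change _ = m + g.norm at this
      omega
    · have := norm_mk_of_isReduced h
      rw [← mul_mk, mk_toWord, List.length_append, invRev_length, hB, ← inv_mk] at this
      change _ = m + g.norm at this
      omega
  · intro h
    have := norm_mul_le (mk B)⁻¹ g
    have := norm_mul_le (mk A) g
    omega

theorem card_norm_le_inter (t : FreeGroup α) (m : ℕ) (ht : t.norm = 2 * m) (n : ℕ) :
    Nat.card {h : FreeGroup α | h.norm ≤ n + m ∧ (t * h).norm ≤ n + m} =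
      Nat.card {h : FreeGroup α | h.norm ≤ n} := by
  obtain ⟨b, hb⟩ := exists_midpoint t m ht
  refine (Nat.card_congr ((Equiv.mulLeft b⁻¹).subtypeEquiv fun g => ?_)).symm
  have := hb g (n + m)
  simp only [Set.mem_ofPred_eq, Equiv.coe_mulLeft]
  rw [this]
  omega

end Midpoint

section Count

variable {α : Type*} [DecidableEq α] [Fintype α]

/-- The reduced words of length at most `n`. -/
def reducedWords : ℕ → Finset (List (α × Bool))
  | 0 => {[]}
  | n + 1 => insert []
      (((reducedWords n).sigma fun w =>
        Finset.univ.filter fun a : α × Bool => reduce (a :: w) = a :: w).image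
          fun p => p.2 :: p.1)

theorem mem_reducedWords {n : ℕ} {L : List (α × Bool)} :
    L ∈ reducedWords n ↔ IsReduced L ∧ L.length ≤ n := by
  induction n generalizing L with
  | zero =>
    simp only [reducedWords, Finset.mem_singleton, Nat.le_zero, List.length_eq_zero_iff]
    constructor
    · rintro rfl; exact ⟨List.isChain_nil, rfl⟩
    · exact And.right
  | succ n ih =>
    simp only [reducedWords, Finset.mem_insert, Finset.mem_image, Finset.mem_sigma,
      Finset.mem_filter, Finset.mem_univ, true_and, Sigma.exists, ih, ← isReduced_iff_reduce_eq]
    rcases L with _ | ⟨a, L⟩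
    · simp
    · constructor
      · rintro (h | ⟨w, b, ⟨h1, h2⟩, h⟩)
        · simp at h
        · obtain ⟨rfl, rfl⟩ := List.cons.inj h
          exact ⟨h2, by simpa using h1.2⟩
      · rintro ⟨h1, h2⟩
        exact Or.inr ⟨L, a, ⟨⟨(List.isChain_cons.1 h1).2, by simpa using h2⟩, h1⟩, rfl⟩

theorem card_filter_reduce_cons {w : List (α × Bool)} (hw : IsReduced w) :
    ((Finset.univ.filter fun a : α × Bool => reduce (a :: w) = a :: w).card : ℤ) =
      2 * Fintype.card α - 1 + if w = [] then 1 else 0 := by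
  rcases w with _ | ⟨b, w⟩
  · simp [mul_comm]
  · have : (Finset.univ.filter fun a : α × Bool => reduce (a :: b :: w) = a :: b :: w) =
        Finset.univ.erase (b.1, !b.2) := by
      ext ⟨a, x⟩
      obtain ⟨b, y⟩ := b
      simp only [Finset.mem_filter, Finset.mem_univ, true_and, Finset.mem_erase, and_true,
        ← isReduced_iff_reduce_eq, isReduced_cons_cons, hw, ne_eq, Prod.mk.injEq]
      cases x <;> cases y <;> simp
    have hpos : 0 < Fintype.card α := Fintype.card_pos_iff.2 ⟨b.1⟩
    rw [this, Finset.card_erase_of_mem (Finset.mem_univ _), Finset.card_univ, Fintype.card_prod,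
      Fintype.card_bool]
    simp
    omega

theorem card_reducedWords_succ (n : ℕ) :
    ((reducedWords (α := α) (n + 1)).card : ℤ) =
      (2 * Fintype.card α - 1) * (reducedWords (α := α) n).card + 2 := by
  rw [reducedWords, Finset.card_insert_of_notMem (by simp), Finset.card_image_of_injective,
    Finset.card_sigma]
  · push_cast
    rw [Finset.sum_congr rfl fun w hw => card_filter_reduce_cons (mem_reducedWords.1 hw).1,
      Finset.sum_add_distrib, Finset.sum_ite_eq' (reducedWords n) ([] : List (α × Bool)),
      if_pos (mem_reducedWords.2 ⟨List.isChain_nil, by simp⟩)]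
    simp
    ring
  · rintro ⟨w, a⟩ ⟨w', a'⟩ h
    obtain ⟨rfl, rfl⟩ := List.cons.inj h
    rfl

theorem card_norm_le_eq_card_reducedWords (n : ℕ) :
    Nat.card {h : FreeGroup α | h.norm ≤ n} = (reducedWords (α := α) n).card := by
  rw [← Nat.card_eq_finsetCard]
  refine Nat.card_congr (Equiv.ofBijective
    (fun h => ⟨h.1.toWord, mem_reducedWords.2 ⟨isReduced_toWord, h.2⟩⟩) ⟨?_, ?_⟩)
  · intro x y h
    exact Subtype.ext (toWord_injective (congrArg Subtype.val h))
  · rintro ⟨L, hL⟩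
    have hL' := mem_reducedWords.1 hL
    refine ⟨⟨mk L, ?_⟩, Subtype.ext ?_⟩
    · exact (norm_mk_of_isReduced hL'.1).trans_le hL'.2
    · exact toWord_mk.trans hL'.1.reduce_eq

theorem card_norm_le (n : ℕ) :
    (2 * (Fintype.card α : ℝ) - 2) * Nat.card {h : FreeGroup α | h.norm ≤ n} =
      2 * Fintype.card α * (2 * Fintype.card α - 1) ^ n - 2 := by
  rw [card_norm_le_eq_card_reducedWords]
  induction n with
  | zero => simp [reducedWords]
  | succ n ih =>
    have h : ((reducedWords (α := α) (n + 1)).card : ℝ) =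
        (2 * Fintype.card α - 1) * (reducedWords (α := α) n).card + 2 := by
      exact_mod_cast card_reducedWords_succ (α := α) n
    rw [h, pow_succ]
    linear_combination (2 * (Fintype.card α : ℝ) - 1) * ih

end Count

end FreeGroup

theorem tendsto_sub_div_mul_pow_sub {q c d : ℝ} (hq : 1 < q) (hc : c ≠ 0) (m : ℕ) :
    Filter.Tendsto (fun n : ℕ => (c * q ^ n - d) / (c * q ^ (n + m) - d))
      Filter.atTop (nhds (1 / q ^ m)) := by
  have hq0 : q ≠ 0 := by positivity
  have hr : Filter.Tendsto (fun n : ℕ => d * q⁻¹ ^ n) Filter.atTop (nhds 0) := by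
    simpa using (tendsto_pow_atTop_nhds_zero_of_lt_one (by positivity)
      (inv_lt_one_of_one_lt₀ hq)).const_mul d
  have h := (hr.const_sub c).div (hr.const_sub (c * q ^ m)) (by simp [hc, hq0])
  have hlim : (c - 0) / (c * q ^ m - 0) = 1 / q ^ m := by
    field_simp
    simp
  rw [hlim] at h
  refine h.congr fun n => ?_
  have hn : q ^ n ≠ 0 := pow_ne_zero n hq0
  rw [Pi.div_apply, ← mul_div_mul_right _ _ hn, sub_mul, sub_mul, mul_assoc d, ← mul_pow,
    inv_mul_cancel₀ hq0, one_pow, mul_one, pow_add]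
  ring_nf

/-- in the free group on `k ≥ 2` generators, for `t` of even word length
`2m`, the ratio `|T_n(t)| / |B_n|` converges to `1 / (2k−1)^m` as `n → ∞`. -/
theorem ratio_T_ball_tendsto_even (k : ℕ) (hk : 2 ≤ k)
    (t : FreeGroup (Fin k)) (m : ℕ) (ht : t.norm = 2 * m) :
    Filter.Tendsto
      (fun n : ℕ =>
        (Nat.card {h : FreeGroup (Fin k) | h.norm ≤ n ∧ (t * h).norm ≤ n} : ℝ) /
          (Nat.card {h : FreeGroup (Fin k) | h.norm ≤ n} : ℝ))
      Filter.atTop (nhds (1 / (2 * (k : ℝ) - 1) ^ m)) := by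
  have hk' : (2 : ℝ) ≤ k := by exact_mod_cast hk
  rw [← Filter.tendsto_add_atTop_iff_nat m]
  refine (tendsto_sub_div_mul_pow_sub (q := 2 * k - 1) (c := 2 * k) (d := 2)
    (by linarith) (by positivity) m).congr fun n => ?_
  have h := FreeGroup.card_norm_le (α := Fin k)
  rw [Fintype.card_fin] at h
  rw [FreeGroup.card_norm_le_inter t m ht, ← h, ← h, mul_div_mul_left _ _ (by linarith)]
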